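/- Let Δ be a simplicial tree such that its facet ideal I(Δ) has a linear resolution. Then there exists an ordering F_1,...,F_r of the facets of Δ that is simultaneously a good leaf ordering and satisfies dist_Δ(F_i, F_{i+1}) = 1 for all 1 ≤ i ≤ r−1. -/

import Mathlib

open MvPolynomial

structure MinFreeRes (k σ : Type) [Field k] (I : Ideal (MvPolynomial σ k)) where
  b : ℕ → ℕ
  deg : (i : ℕ) → Fin (b i) → ℕ
  d : (i : ℕ) → ((Fin (b (i + 1)) → MvPolynomial σ k) →ₗ[MvPolynomial σ k]
        (Fin (b i) → MvPolynomial σ k))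
  aug : (Fin (b 0) → MvPolynomial σ k) →ₗ[MvPolynomial σ k] (MvPolynomial σ k ⧸ I)
  aug_surjective : Function.Surjective aug
  exact_zero : Function.Exact (d 0) aug
  exact_succ : ∀ i : ℕ, Function.Exact (d (i + 1)) (d i)
  aug_homog : ∀ j : Fin (b 0), ∃ p : MvPolynomial σ k,
      p.IsHomogeneous (deg 0 j) ∧ aug (Pi.single j 1) = Ideal.Quotient.mk I p
  d_homog : ∀ (i : ℕ) (j : Fin (b (i + 1))) (l : Fin (b i)),
      (d i (Pi.single j 1) l).IsHomogeneous (deg (i + 1) j - deg i l) ∧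
        (deg (i + 1) j < deg i l → d i (Pi.single j 1) l = 0)
  minimal : ∀ (i : ℕ) (j : Fin (b (i + 1))) (l : Fin (b i)),
      MvPolynomial.constantCoeff (d i (Pi.single j 1) l) = 0

/-- The Castelnuovo-Mumford regularity of the module `R/I`, defined as the supremum of
`j - i` over the nonzero graded Betti numbers `β_{i,j}(R/I)`, read off from (any)
minimal graded free resolution of `R/I`. -/
noncomputable def reg (k σ : Type) [Field k] (I : Ideal (MvPolynomial σ k)) : ℤ :=
  sSup {x : ℤ | ∃ F : MinFreeRes k σ I, ∃ i : ℕ, ∃ j : Fin (F.b i), x = (F.deg i j : ℤ) - i}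

/-- The ideal `I`, equigenerated in some degree `t`, has a linear resolution:
`β_{i,j}(I) = 0` for `j ≠ t + i`.  (In a minimal free resolution of `R/I`, homological
degree `i+1` records the Betti numbers `β_{i,j}(I)` of the ideal.) -/
def HasLinearResolution (k σ : Type) [Field k] (I : Ideal (MvPolynomial σ k)) : Prop :=
  ∃ t : ℕ, ∀ F : MinFreeRes k σ I, ∀ i : ℕ, ∀ j : Fin (F.b (i + 1)),
    F.deg (i + 1) j = t + i

set_option linter.unusedSectionVars false

/-- distance between two facets of the same size -/
def ddist {ι σ : Type} [DecidableEq σ] (F : ι → Finset σ) (p q : ι) : ℕ := (F p \ F q).card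

structure GoodCplx {ι σ : Type} [DecidableEq σ] (F : ι → Finset σ) (t : ℕ) : Prop where
  card : ∀ p, (F p).card = t
  anti : ∀ p q, p ≠ q → ¬ F p ⊆ F q
  forest : ∀ S : Finset ι, S.Nonempty → ∃ i ∈ S,
      (S = {i} ∨ ∃ j ∈ S, j ≠ i ∧ ∀ l ∈ S, l ≠ i → F l ∩ F i ⊆ F j ∩ F i)
  conn : ∀ G H, Relation.ReflTransGen
    (fun p q => F p ⊆ F G ∪ F H ∧ F q ⊆ F G ∪ F H ∧ ddist F p q = 1) G H

namespace GoodCplx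

variable {ι σ : Type} [DecidableEq ι] [DecidableEq σ] {F : ι → Finset σ} {t : ℕ}

lemma comm (h : GoodCplx F t) (p q : ι) : ddist F p q = ddist F q p :=
  Finset.card_sdiff_comm (by rw [h.card, h.card])

lemma tri (F : ι → Finset σ) (p s q : ι) : ddist F p q ≤ ddist F p s + ddist F s q := by
  unfold ddist
  refine (Finset.card_le_card ?_).trans (Finset.card_union_le _ _)
  intro x hx
  simp only [Finset.mem_sdiff, Finset.mem_union] at hx ⊢
  tauto

lemma self (F : ι → Finset σ) (p : ι) : ddist F p p = 0 := by simp [ddist]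

lemma pos (h : GoodCplx F t) {p q : ι} (hpq : p ≠ q) : 1 ≤ ddist F p q := by
  have := h.anti p q hpq
  unfold ddist
  rw [Nat.one_le_iff_ne_zero, Finset.card_ne_zero]
  exact Finset.sdiff_nonempty.2 this

lemma ne_of_pos {p q : ι} (hpq : 1 ≤ ddist F p q) : p ≠ q := by
  rintro rfl
  simp [self] at hpq

lemma inter_card (h : GoodCplx F t) (p q : ι) : (F p ∩ F q).card + ddist F p q = t := by
  have := Finset.card_sdiff_add_card_inter (F p) (F q)
  rw [h.card] at this
  unfold ddist; omega

lemma between (F : ι → Finset σ) {p s q : ι} (hd : ddist F p s + ddist F s q ≤ ddist F p q) :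
    F p ∩ F q ⊆ F s := by
  intro x hx
  by_contra hxs
  simp only [Finset.mem_inter] at hx
  have hsub : insert x (F p \ F q) ⊆ (F p \ F s) ∪ (F s \ F q) := by
    intro y hy
    simp only [Finset.mem_insert, Finset.mem_sdiff, Finset.mem_union] at hy ⊢
    rcases hy with rfl | hy <;> tauto
  have h1 := (Finset.card_le_card hsub).trans (Finset.card_union_le _ _)
  rw [Finset.card_insert_of_notMem (by simp [hx.2])] at h1
  unfold ddist at hd
  omega

/-- two neighbours through the same ridge -/
lemma same_ridge (h : GoodCplx F t) {x y z : ι} (hxy : ddist F x y = 1)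
    (hr : F x ∩ F y = F x ∩ F z) (hyz : y ≠ z) : ddist F y z = 1 := by
  have h1 := h.inter_card x y
  have h2 := h.inter_card y z
  have h3 := h.pos hyz
  have h4 : (F x ∩ F y).card ≤ (F y ∩ F z).card := Finset.card_le_card (by
    intro v hv
    have hv' := hv
    rw [hr] at hv'
    simp only [Finset.mem_inter] at hv hv' ⊢
    tauto)
  omega

/-- a leaf has at most one ridge -/
lemma exists_leaf (h : GoodCplx F t) (S : Finset ι) (hS : S.Nonempty) :
    ∃ x ∈ S, ∀ y ∈ S, ddist F x y = 1 → ∀ z ∈ S, z ≠ x → F x ∩ F z ⊆ F x ∩ F y := by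
  obtain ⟨x, hx, hh⟩ := h.forest S hS
  refine ⟨x, hx, fun y hy hxy z hz hzx => ?_⟩
  rcases hh with rfl | ⟨j, hj, hjx, hh⟩
  · simp at hz; exact absurd hz hzx
  have hyx : y ≠ x := (ne_of_pos hxy.ge).symm
  have h1 := hh y hy hyx
  have h2 := h.inter_card x y
  have h3 := h.inter_card x j
  have h4 := h.pos hjx.symm
  rw [Finset.inter_comm (F y), Finset.inter_comm (F j)] at h1
  have h5 : F x ∩ F y = F x ∩ F j := Finset.eq_of_subset_of_card_le h1 (by omega)
  rw [h5, Finset.inter_comm (F x) (F z), Finset.inter_comm (F x) (F j)]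
  exact hh z hz hzx

lemma ridge_eq (h : GoodCplx F t) {x y z : ι} (hxy : ddist F x y = 1) (hxz : ddist F x z = 1)
    (hs : F x ∩ F z ⊆ F x ∩ F y) : F x ∩ F y = F x ∩ F z := by
  have h2 := h.inter_card x y
  have h3 := h.inter_card x z
  exact (Finset.eq_of_subset_of_card_le hs (by omega)).symm

/-- every set with two elements has two ends -/
lemma two_ends (h : GoodCplx F t) (n : ℕ) : ∀ S : Finset ι, S.card = n + 2 →
    ∃ u ∈ S, ∃ v ∈ S, u ≠ v ∧
      (∀ y ∈ S, ∀ z ∈ S, ddist F u y = 1 → ddist F u z = 1 → F u ∩ F y = F u ∩ F z) ∧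
      (∀ y ∈ S, ∀ z ∈ S, ddist F v y = 1 → ddist F v z = 1 → F v ∩ F y = F v ∩ F z) := by
  induction n with
  | zero =>
    intro S hS
    obtain ⟨u, v, huv, rfl⟩ := Finset.card_eq_two.1 hS
    refine ⟨u, by simp, v, by simp, huv, ?_, ?_⟩
    · intro y hy z hz h1 h2
      have := ne_of_pos h1.ge
      have := ne_of_pos h2.ge
      simp at hy hz
      grind
    · intro y hy z hz h1 h2
      have := ne_of_pos h1.ge
      have := ne_of_pos h2.ge
      simp at hy hz
      grind
  | succ n ih =>
    intro S hS
    obtain ⟨x, hx, hl⟩ := h.exists_leaf S (Finset.card_pos.1 (by omega))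
    have hl' : ∀ y ∈ S, ∀ z ∈ S, ddist F x y = 1 → ddist F x z = 1 → F x ∩ F y = F x ∩ F z := by
      intro y hy z hz h1 h2
      exact h.ridge_eq h1 h2 (hl y hy h1 z hz (ne_of_pos h2.ge).symm)
    obtain ⟨u, hu, v, hv, huv, hu', hv'⟩ := ih (S.erase x) (by rw [Finset.card_erase_of_mem hx]; omega)
    rw [Finset.mem_erase] at hu hv
    -- unspoiled element
    have key : ∀ w ∈ S, w ≠ x → (∀ y ∈ S.erase x, ∀ z ∈ S.erase x,
        ddist F w y = 1 → ddist F w z = 1 → F w ∩ F y = F w ∩ F z) →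
        (ddist F w x = 1 → ∃ y ∈ S.erase x, ddist F w y = 1 ∧ F w ∩ F x = F w ∩ F y) →
        (∀ y ∈ S, ∀ z ∈ S, ddist F w y = 1 → ddist F w z = 1 → F w ∩ F y = F w ∩ F z) := by
      intro w hw hwx h1 h2
      have h3 : ∀ y ∈ S, ddist F w x = 1 → ddist F w y = 1 → F w ∩ F x = F w ∩ F y := by
        intro y hy hwx hwy
        by_cases hyx : y = x
        · rw [hyx]
        · obtain ⟨y', hy', ha, hb⟩ := h2 hwx
          rw [hb]
          exact h1 y' hy' y (Finset.mem_erase.2 ⟨hyx, hy⟩) ha hwy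
      intro y hy z hz hwy hwz
      by_cases hyx : y = x
      · subst hyx; exact h3 z hz hwy hwz
      by_cases hzx : z = x
      · subst hzx; exact (h3 y hy hwz hwy).symm
      exact h1 y (Finset.mem_erase.2 ⟨hyx, hy⟩) z (Finset.mem_erase.2 ⟨hzx, hz⟩) hwy hwz
    by_cases hux : ddist F u x = 1
    · by_cases hvx : ddist F v x = 1
      · -- both adjacent to x
        have hxu : ddist F x u = 1 := by rw [h.comm]; exact hux
        have hxv : ddist F x v = 1 := by rw [h.comm]; exact hvx
        have e1 := hl' u hu.2 v hv.2 hxu hxv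
        have e2 := h.same_ridge hxu e1 huv
        refine ⟨x, hx, u, hu.2, hu.1.symm, hl', key u hu.2 hu.1 hu' ?_⟩
        intro _
        refine ⟨v, Finset.mem_erase.2 hv, e2, ?_⟩
        refine h.ridge_eq hux e2 ?_ 
        have c1 := h.inter_card u x
        have c2 := h.inter_card u v
        have : F u ∩ F x = F u ∩ F v := Finset.eq_of_subset_of_card_le (by
          intro w hw
          have : w ∈ F x ∩ F u := by simpa [and_comm] using hw
          rw [e1] at this
          simp only [Finset.mem_inter] at *
          tauto) (by omega)
        rw [this]
      · exact ⟨x, hx, v, hv.2, hv.1.symm, hl', key v hv.2 hv.1 hv' (fun hh => absurd hh hvx)⟩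
    · exact ⟨x, hx, u, hu.2, hu.1.symm, hl', key u hu.2 hu.1 hu' (fun hh => absurd hh hux)⟩

/-- three facets: one contains the intersection of the two others -/
lemma three (h : GoodCplx F t) {p q s : ι} (hpq : p ≠ q) (hps : p ≠ s) (hqs : q ≠ s) :
    F p ∩ F q ⊆ F s ∨ F p ∩ F s ⊆ F q ∨ F q ∩ F s ⊆ F p := by
  obtain ⟨i, hi, hh⟩ := h.forest {p, q, s} (by simp)
  have hne : ({p, q, s} : Finset ι) ≠ {i} := by
    intro he
    have : p ∈ ({i} : Finset ι) := by rw [← he]; simp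
    have : q ∈ ({i} : Finset ι) := by rw [← he]; simp
    simp_all
  rcases hh with hh | ⟨j, hj, hji, hh⟩
  · exact absurd hh hne
  have a1 := hh p (by simp)
  have a2 := hh q (by simp)
  have a3 := hh s (by simp)
  simp only [Finset.mem_insert, Finset.mem_singleton] at hi hj
  simp only [Finset.subset_iff, Finset.mem_inter] at *
  grind

/-- the removal step -/
lemma remove (F : ι → Finset σ) (S : Finset ι) (x G : ι) (hGx : G ≠ x)
    (h : GoodCplx F t)
    (hl : ∀ y ∈ S, ∀ z ∈ S, ddist F x y = 1 → ddist F x z = 1 → F x ∩ F y = F x ∩ F z)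
    (W : ι) (hW : Relation.ReflTransGen (fun p q => p ∈ S ∧ q ∈ S ∧ ddist F p q = 1) G W) :
    (W ≠ x → Relation.ReflTransGen
      (fun p q => p ∈ S.erase x ∧ q ∈ S.erase x ∧ ddist F p q = 1) G W) ∧
    (W = x → ∃ y ∈ S, y ≠ x ∧ ddist F y x = 1 ∧ Relation.ReflTransGen
      (fun p q => p ∈ S.erase x ∧ q ∈ S.erase x ∧ ddist F p q = 1) G y) := by
  induction hW with
  | refl => exact ⟨fun _ => .refl, fun hh => absurd hh hGx⟩
  | @tail W V _ hWV ih =>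
    obtain ⟨hWS, hVS, hd⟩ := hWV
    refine ⟨fun hVx => ?_, fun hVx => ?_⟩
    · by_cases hWx : W = x
      · obtain ⟨y, hy, hyx, hyd, hr⟩ := ih.2 hWx
        subst hWx
        by_cases hyV : y = V
        · rw [← hyV]; exact hr
        · rw [h.comm] at hyd
          have := h.same_ridge hyd (hl y hy V hVS hyd hd) hyV
          exact hr.tail ⟨Finset.mem_erase.2 ⟨hyx, hy⟩, Finset.mem_erase.2 ⟨hVx, hVS⟩, this⟩
      · exact (ih.1 hWx).tail ⟨Finset.mem_erase.2 ⟨hWx, hWS⟩, Finset.mem_erase.2 ⟨hVx, hVS⟩, hd⟩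
    · subst hVx
      have hWx := ne_of_pos hd.ge
      exact ⟨W, hWS, hWx, hd, ih.1 hWx⟩

lemma one_side (h : GoodCplx F t) {G H y : ι} (hGy : ddist F G y = 1) (hyG : F y ⊆ F G ∪ F H)
    (hs : F G ∩ F H ⊆ F G ∩ F y) : ddist F y H + 1 = ddist F G H := by
  have h1 := h.inter_card G H
  have h2 := h.inter_card y H
  have h3 := tri F G y H
  have h4 : 1 ≤ (F y \ F G).card := by
    have := h.comm G y
    unfold ddist at this hGy
    omega
  have h5 : (F G ∩ F H).card + 1 ≤ (F y ∩ F H).card := by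
    obtain ⟨b, hb⟩ := Finset.card_pos.1 h4
    have hbH : b ∈ F H := by
      have := hyG (Finset.mem_sdiff.1 hb).1
      simp only [Finset.mem_sdiff, Finset.mem_union] at *
      tauto
    have : insert b (F G ∩ F H) ⊆ F y ∩ F H := by
      intro w hw
      rw [Finset.mem_insert] at hw
      rcases hw with rfl | hw
      · simp only [Finset.mem_sdiff, Finset.mem_inter] at *
        tauto
      · have := hs hw
        simp only [Finset.mem_inter] at *
        tauto
    have := Finset.card_le_card this
    rwa [Finset.card_insert_of_notMem] at this
    simp only [Finset.mem_sdiff, Finset.mem_inter] at *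
    tauto
  omega

lemma step_aux (h : GoodCplx F t) (n : ℕ) : ∀ (S : Finset ι) (G H : ι), S.card = n → G ∈ S → G ≠ H →
    (∀ p ∈ S, F p ⊆ F G ∪ F H) →
    Relation.ReflTransGen (fun p q => p ∈ S ∧ q ∈ S ∧ ddist F p q = 1) G H →
    ∃ y, (ddist F G y = 1 ∧ ddist F y H + 1 = ddist F G H) ∨
      (ddist F y H = 1 ∧ ddist F G y + 1 = ddist F G H) := by
  induction n with
  | zero =>
    intro S G H hS hG
    rw [Finset.card_eq_zero] at hS
    simp [hS] at hG
  | succ n ih =>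
    intro S G H hS hG hGH hsub hr
    have hHS : H ∈ S := by
      rcases hr.cases_tail with he | ⟨c, _, hc⟩
      · exact absurd he.symm hGH
      · exact hc.2.1
    obtain ⟨x, hx, hl⟩ := h.exists_leaf S ⟨G, hG⟩
    by_cases hxG : x = G
    · subst hxG
      rcases hr.cases_head with he | ⟨c, hc, _⟩
      · exact absurd he hGH
      · refine ⟨c, Or.inl ⟨hc.2.2, ?_⟩⟩
        exact h.one_side hc.2.2 (hsub c hc.2.1) (hl c hc.2.1 hc.2.2 H hHS hGH.symm)
    by_cases hxH : x = H
    · subst hxH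
      rcases hr.cases_tail with he | ⟨c, _, hc⟩
      · exact absurd he.symm hGH
      · refine ⟨c, Or.inr ⟨hc.2.2, ?_⟩⟩
        have hd : ddist F x c = 1 := by rw [h.comm]; exact hc.2.2
        have := h.one_side (H := G) hd (by rw [Finset.union_comm]; exact hsub c hc.1)
          (hl c hc.1 hd G hG hGH)
        rw [h.comm G c, h.comm G x]; exact this
    have hl' : ∀ y ∈ S, ∀ z ∈ S, ddist F x y = 1 → ddist F x z = 1 → F x ∩ F y = F x ∩ F z := by
      intro y hy z hz h1 h2
      exact h.ridge_eq h1 h2 (hl y hy h1 z hz (ne_of_pos h2.ge).symm)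
    refine ih (S.erase x) G H (by rw [Finset.card_erase_of_mem hx]; omega)
      (Finset.mem_erase.2 ⟨Ne.symm hxG, hG⟩) hGH (fun p hp => hsub p (Finset.mem_of_mem_erase hp)) ?_
    exact (remove F S x G (Ne.symm hxG) h hl' H hr).1 (Ne.symm hxH)

/-- isometry -/
lemma step [Fintype ι] (h : GoodCplx F t) (n : ℕ) : ∀ (G H : ι), ddist F G H = n + 1 →
    ∃ y, ddist F G y = 1 ∧ ddist F y H = n := by
  induction n with
  | zero => intro G H hd; exact ⟨H, hd, self F H⟩
  | succ n ih =>
    intro G H hd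
    have hGH : G ≠ H := ne_of_pos (F := F) (by omega)
    have hr := h.conn G H
    obtain ⟨y, hy | hy⟩ := h.step_aux _ (Finset.univ.filter fun p => F p ⊆ F G ∪ F H) G H rfl
      (by simp) hGH (by simp) (Relation.ReflTransGen.mono (by
        intro a b hab
        simpa using hab) _ _ hr)
    · exact ⟨y, hy.1, by omega⟩
    · obtain ⟨z, hz1, hz2⟩ := ih G y (by omega)
      have := tri F z y H
      have := tri F G z H
      exact ⟨z, hz1, by omega⟩

end GoodCplx

namespace GoodCplx

variable {ι σ : Type} [DecidableEq ι] [DecidableEq σ] {F : ι → Finset σ} {t : ℕ}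

lemma far_ridge (h : GoodCplx F t) {Z c w p : ι} (hcw : ddist F w c = 1)
    (hlt : ddist F p Z + 2 ≤ ddist F c Z) : F w ∩ F c ≠ F w ∩ F p := by
  intro he
  have hcp : c ≠ p := by rintro rfl; omega
  have h1 := h.same_ridge hcw he hcp
  have := tri F c p Z
  omega

lemma unique_ridge [Fintype ι] (h : GoodCplx F t) {Z X Y Y' : ι} (hXZ : X ≠ Z)
    (hY : ddist F X Y = 1) (hY' : ddist F X Y' = 1)
    (hle : ddist F Y Z ≤ ddist F X Z) (hle' : ddist F Y' Z ≤ ddist F X Z) :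
    F X ∩ F Y = F X ∩ F Y' := by
  classical
  have hpar : ∀ W, ∃ y, (W ≠ Z → ddist F W y = 1 ∧ ddist F y Z + 1 = ddist F W Z) ∧
      (W = Z → y = Z) := by
    intro W
    by_cases hW : W = Z
    · exact ⟨Z, fun hh => absurd hW hh, fun _ => rfl⟩
    · have := h.pos hW
      obtain ⟨y, hy1, hy2⟩ := h.step (ddist F W Z - 1) W Z (by omega)
      exact ⟨y, fun _ => ⟨hy1, by omega⟩, fun hh => absurd hh hW⟩
  choose par hp hpZ using hpar
  have hlow : ∀ Y, ddist F X Y = 1 → ddist F Y Z < ddist F X Z → Y ≠ Z →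
      F Y ∩ F X ≠ F Y ∩ F (par Y) := by
    intro Y hY hlt hYZ
    have := hp Y hYZ
    exact h.far_ridge (Z := Z) (by rw [h.comm]; exact hY) (by omega)
  have norm : ∀ Y, ddist F X Y = 1 → ddist F Y Z ≤ ddist F X Z → ∃ Y1, ddist F X Y1 = 1 ∧
      F X ∩ F Y1 = F X ∩ F Y ∧ (Y1 ≠ Z → F Y1 ∩ F X ≠ F Y1 ∩ F (par Y1)) := by
    intro Y hY hle
    by_cases hYZ : Y = Z
    · exact ⟨Y, hY, rfl, fun hh => absurd hYZ hh⟩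
    by_cases he : F Y ∩ F X = F Y ∩ F (par Y)
    · have h1 := hp Y hYZ
      have hYX : ddist F Y X = 1 := by rw [h.comm]; exact hY
      have hne : X ≠ par Y := by intro hh; rw [← hh] at h1; omega
      have h2 := h.same_ridge hYX he hne
      refine ⟨par Y, h2, ?_, fun hZ => hlow _ h2 (by omega) hZ⟩
      refine h.ridge_eq h2 hY ?_
      intro v hv
      have hv' : v ∈ F Y ∩ F X := by rw [Finset.inter_comm]; exact hv
      rw [he] at hv'
      simp only [Finset.mem_inter] at *
      tauto
    · exact ⟨Y, hY, rfl, fun _ => he⟩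
  obtain ⟨A, hA1, hA2, hA3⟩ := norm Y hY hle
  obtain ⟨B, hB1, hB2, hB3⟩ := norm Y' hY' hle'
  rw [← hA2, ← hB2]
  by_contra hAB
  let S : Finset ι := Finset.univ.filter fun W =>
    W = X ∨ (∃ n : ℕ, W = par^[n] A) ∨ (∃ n : ℕ, W = par^[n] B)
  have hXS : X ∈ S := by simp [S]
  have hAn : ∀ n : ℕ, par^[n] A ∈ S := by
    intro n; simp only [S, Finset.mem_filter, Finset.mem_univ, true_and]
    exact Or.inr (Or.inl ⟨n, rfl⟩)
  have hBn : ∀ n : ℕ, par^[n] B ∈ S := by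
    intro n; simp only [S, Finset.mem_filter, Finset.mem_univ, true_and]
    exact Or.inr (Or.inr ⟨n, rfl⟩)
  have notend : ∀ w ∈ S, w ≠ Z →
      ¬ (∀ y ∈ S, ∀ z ∈ S, ddist F w y = 1 → ddist F w z = 1 → F w ∩ F y = F w ∩ F z) := by
    have gen : ∀ A, ddist F X A = 1 → (A ≠ Z → F A ∩ F X ≠ F A ∩ F (par A)) →
        (∀ n : ℕ, par^[n] A ∈ S) → ∀ n : ℕ, par^[n] A ≠ Z →
        ¬ (∀ y ∈ S, ∀ z ∈ S, ddist F (par^[n] A) y = 1 → ddist F (par^[n] A) z = 1 →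
          F (par^[n] A) ∩ F y = F (par^[n] A) ∩ F z) := by
      intro A hA1 hA3 hAn n hnZ hall
      cases n with
      | zero =>
        simp only [Function.iterate_zero, id] at hnZ hall
        refine hA3 hnZ (hall X hXS (par A) (hAn 1) (by rw [h.comm]; exact hA1) (hp A hnZ).1)
      | succ n =>
        have hs : par^[n+1] A = par (par^[n] A) := Function.iterate_succ_apply' _ _ _
        have hs2 : par^[n+2] A = par (par^[n+1] A) := Function.iterate_succ_apply' _ _ _
        have hcZ : par^[n] A ≠ Z := by
          intro hh
          exact hnZ (by rw [hs]; exact hpZ _ hh)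
        have p1 := hp _ hcZ
        have p2 := hp _ hnZ
        rw [← hs] at p1
        rw [← hs2] at p2
        have p3 : ddist F (par^[n+1] A) (par^[n] A) = 1 := by rw [h.comm]; exact p1.1
        exact h.far_ridge (Z := Z) p3 (by omega) (hall _ (hAn n) _ (hAn (n+2)) p3 p2.1)
    intro w hw hwZ hall
    have hw' := hw
    simp only [S, Finset.mem_filter, Finset.mem_univ, true_and] at hw'
    rcases hw' with rfl | ⟨n, rfl⟩ | ⟨n, rfl⟩
    · exact hAB (hall A (hAn 0) B (hBn 0) hA1 hB1)
    · exact gen A hA1 hA3 hAn n hwZ hall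
    · exact gen B hB1 hB3 hBn n hwZ hall
  have hcard : 2 ≤ S.card := by
    have : ({X, A} : Finset ι) ⊆ S := by
      intro v hv
      simp only [Finset.mem_insert, Finset.mem_singleton] at hv
      rcases hv with rfl | rfl
      · exact hXS
      · exact hAn 0
    have := Finset.card_le_card this
    rwa [Finset.card_pair (ne_of_pos hA1.ge)] at this
  obtain ⟨u, hu, v, hv, huv, hu', hv'⟩ := h.two_ends (S.card - 2) S (by omega)
  by_cases huZ : u = Z
  · exact notend v hv (by rw [← huZ]; exact huv.symm) hv'
  · exact notend u hu huZ hu'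

lemma exists_path [Fintype ι] (h : GoodCplx F t) (n : ℕ) : ∀ (G H : ι), ddist F G H = n →
    ∃ E : ℕ → ι, E 0 = G ∧ E n = H ∧ ∀ i < n, ddist F (E i) (E (i + 1)) = 1 := by
  induction n with
  | zero =>
    intro G H hd
    have : G = H := by
      by_contra hne
      have := h.pos hne
      omega
    exact ⟨fun _ => G, rfl, this, by simp⟩
  | succ n ih =>
    intro G H hd
    obtain ⟨y, hy1, hy2⟩ := h.step n G H hd
    obtain ⟨E, h0, hn, hE⟩ := ih y H hy2
    refine ⟨fun i => Nat.casesOn i G E, rfl, hn, ?_⟩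
    intro i hi
    cases i with
    | zero => simpa [h0] using hy1
    | succ i => exact hE i (by omega)

lemma exists_geodesic [Fintype ι] (h : GoodCplx F t) (L : ℕ) (G H : ι) (hd : ddist F G H = L) :
    ∃ E : ℕ → ι, E 0 = G ∧ E L = H ∧ ∀ i j, i ≤ j → j ≤ L → ddist F (E i) (E j) = j - i := by
  obtain ⟨E, h0, hL, hE⟩ := h.exists_path L G H hd
  have up : ∀ i k, i + k ≤ L → ddist F (E i) (E (i + k)) ≤ k := by
    intro i k
    induction k with
    | zero => intro _; simp [self]
    | succ k ih =>
      intro hk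
      have h1 := ih (by omega)
      have h2 := hE (i + k) (by omega)
      have h3 := tri F (E i) (E (i + k)) (E (i + k + 1))
      have : i + (k + 1) = i + k + 1 := by omega
      rw [this]; omega
  refine ⟨E, h0, hL, ?_⟩
  intro i j hij hjL
  have h1 := up i (j - i) (by omega)
  have h2 := up 0 i (by omega)
  have h3 := up j (L - j) (by omega)
  rw [show i + (j - i) = j by omega] at h1
  rw [show j + (L - j) = L by omega] at h3
  rw [show 0 + i = i by omega] at h2
  have h4 := tri F (E 0) (E i) (E L)
  have h5 := tri F (E i) (E j) (E L)
  rw [h0, hL] at h4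
  rw [h0] at h2
  rw [hL] at h3 h5
  omega

end GoodCplx

/-- a geodesic chain of facets -/
def IsSpine {ι σ : Type} [DecidableEq σ] (F : ι → Finset σ) (E : ℕ → ι) (L : ℕ) : Prop :=
  ∀ i j, i ≤ j → j ≤ L → ddist F (E i) (E j) = j - i

namespace GoodCplx

variable {ι σ : Type} [DecidableEq ι] [DecidableEq σ] {F : ι → Finset σ} {t : ℕ}
  {E : ℕ → ι} {L : ℕ}

lemma sp_nested (hE : IsSpine F E L) {i j k : ℕ} (hij : i ≤ j) (hjk : j ≤ k) (hk : k ≤ L) :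
    F (E i) ∩ F (E k) ⊆ F (E j) := by
  apply between
  rw [hE i j hij (by omega), hE j k hjk hk, hE i k (by omega) hk]
  omega

lemma sp_left (h : GoodCplx F t) (hE : IsSpine F E L) {i j k : ℕ} (hij : i < j) (hjk : j ≤ k)
    (hk : k ≤ L) : ¬ F (E j) ∩ F (E k) ⊆ F (E i) := by
  intro hs
  have h1 : (F (E j) ∩ F (E k)).card ≤ (F (E i) ∩ F (E k)).card :=
    Finset.card_le_card (fun v hv => Finset.mem_inter.2 ⟨hs hv, (Finset.mem_inter.1 hv).2⟩)
  have h2 := h.inter_card (E j) (E k)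
  have h3 := h.inter_card (E i) (E k)
  rw [hE j k hjk hk] at h2
  rw [hE i k (by omega) hk] at h3
  omega

lemma sp_right (h : GoodCplx F t) (hE : IsSpine F E L) {i j k : ℕ} (hij : i ≤ j) (hjk : j < k)
    (hk : k ≤ L) : ¬ F (E i) ∩ F (E j) ⊆ F (E k) := by
  intro hs
  have h1 : (F (E i) ∩ F (E j)).card ≤ (F (E i) ∩ F (E k)).card :=
    Finset.card_le_card (fun v hv => Finset.mem_inter.2 ⟨(Finset.mem_inter.1 hv).1, hs hv⟩)
  have h2 := h.inter_card (E i) (E j)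
  have h3 := h.inter_card (E i) (E k)
  rw [hE i j hij (by omega)] at h2
  rw [hE i k (by omega) hk] at h3
  omega

lemma inter_eq_of_subset (h : GoodCplx F t) {X A B : ι} (hAB : ddist F A B = 1)
    (hs : F A ∩ F B ⊆ F X) (hX : X ≠ A) : F X ∩ F A = F A ∩ F B := by
  have h1 := h.inter_card A B
  have h2 := h.inter_card X A
  have h3 := h.pos hX
  refine (Finset.eq_of_subset_of_card_le ?_ (by omega)).symm
  intro v hv
  have := hs hv
  simp only [Finset.mem_inter] at *
  tauto

lemma B1 (h : GoodCplx F t) (hE : IsSpine F E L) {X : ι} {a : ℕ} (ha : a + 1 ≤ L)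
    (hs : F (E a) ∩ F (E (a + 1)) ⊆ F X) (hX : ∀ i ≤ L, X ≠ E i) {i : ℕ} (hi : i ≤ L) :
    F X ∩ F (E i) ⊆ F (E a) ∩ F (E (a + 1)) := by
  have hd : ddist F (E a) (E (a + 1)) = 1 := by rw [hE _ _ (by omega) ha]; omega
  have e1 := h.inter_eq_of_subset hd hs (hX a (by omega))
  have e2 := h.inter_eq_of_subset (by rw [h.comm]; exact hd)
    (by rw [Finset.inter_comm]; exact hs) (hX (a + 1) ha)
  rw [Finset.inter_comm (F (E (a + 1)))] at e2
  rcases lt_trichotomy i a with hia | rfl | hia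
  · have ne : E a ≠ E i := (ne_of_pos (F := F) (by rw [hE i a hia.le (by omega)]; omega)).symm
    rcases h.three (hX a (by omega)) (hX i hi) ne with hh | hh | hh
    · rw [e1] at hh
      exact absurd hh (h.sp_left hE hia (by omega) ha)
    · rw [← e1]; exact fun v hv => Finset.mem_inter.2 ⟨(Finset.mem_inter.1 hv).1, hh hv⟩
    · exfalso
      refine h.sp_right hE hia.le (Nat.lt_succ_self a) ha ?_
      intro v hv
      have : v ∈ F X ∩ F (E a) := by
        have := hh (by rw [Finset.inter_comm]; exact hv)
        simp only [Finset.mem_inter] at *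
        tauto
      rw [e1] at this
      exact (Finset.mem_inter.1 this).2
  · exact e1.le
  · by_cases hia' : i = a + 1
    · rw [hia']; exact e2.le
    have hia2 : a + 1 < i := by omega
    have ne : E (a + 1) ≠ E i := (ne_of_pos (F := F) (by rw [hE (a+1) i hia2.le (by omega)]; omega))
    rcases h.three (hX (a + 1) (by omega)) (hX i hi) ne with hh | hh | hh
    · rw [e2] at hh
      exact absurd hh (h.sp_right hE (by omega) hia2 hi)
    · rw [← e2]; exact fun v hv => Finset.mem_inter.2 ⟨(Finset.mem_inter.1 hv).1, hh hv⟩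
    · exfalso
      refine h.sp_left hE (Nat.lt_succ_self a) hia2.le hi ?_
      intro v hv
      have : v ∈ F X ∩ F (E (a + 1)) := by
        have := hh hv
        simp only [Finset.mem_inter] at *
        tauto
      rw [e2] at this
      exact (Finset.mem_inter.1 this).1

lemma B2 (h : GoodCplx F t) (hE : IsSpine F E L) {X Y : ι} {a b : ℕ} (hab : a ≤ b)
    (hb : b + 1 ≤ L)
    (hs : F (E a) ∩ F (E (a + 1)) ⊆ F X) (hX : ∀ i ≤ L, X ≠ E i)
    (hs' : F (E b) ∩ F (E (b + 1)) ⊆ F Y) (hY : ∀ i ≤ L, Y ≠ E i) (hXY : X ≠ Y) :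
    F X ∩ F Y ⊆ F (E a) ∩ F (E (b + 1)) := by
  have hd : ddist F (E a) (E (a + 1)) = 1 := by rw [hE _ _ (by omega) (by omega)]; omega
  rcases hab.eq_or_lt with rfl | hab
  · have h1 := h.inter_card (E a) (E (a + 1))
    have h2 := h.inter_card X Y
    have h3 := h.pos hXY
    have := Finset.eq_of_subset_of_card_le (Finset.subset_inter hs hs') (by omega)
    rw [this]
  have bX : ∀ i ≤ L, _ := fun i hi => h.B1 hE (by omega) hs hX (i := i) hi
  have bY : ∀ i ≤ L, _ := fun i hi => h.B1 hE (by omega) hs' hY (i := i) hi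
  rcases h.three hXY (hX (a + 1) (by omega)) (hY (a + 1) (by omega)) with hh | hh | hh
  · intro v hv
    have h1 := hh hv
    rw [Finset.mem_inter] at hv
    have h2 := bX (a + 1) (by omega) (Finset.mem_inter.2 ⟨hv.1, h1⟩)
    have h3 := bY (a + 1) (by omega) (Finset.mem_inter.2 ⟨hv.2, h1⟩)
    simp only [Finset.mem_inter] at *
    tauto
  · exfalso
    refine h.sp_right hE (i := a) (j := a + 1) (k := b + 1) (by omega) (by omega) hb ?_
    intro v hv
    have h0 := hs hv
    rw [Finset.mem_inter] at hv
    have h1 := hh (Finset.mem_inter.2 ⟨h0, hv.2⟩)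
    have h2 := bY a (by omega) (Finset.mem_inter.2 ⟨h1, hv.1⟩)
    exact (Finset.mem_inter.1 h2).2
  · exfalso
    refine h.sp_left hE (i := a) (j := a + 1) (k := b + 1) (by omega) (by omega) hb ?_
    intro v hv
    have h0 := sp_nested hE (i := a + 1) (j := b) (k := b + 1) (by omega) (by omega) hb hv
    rw [Finset.mem_inter] at hv
    have h1 := hs' (Finset.mem_inter.2 ⟨h0, hv.2⟩)
    have h2 := hh (Finset.mem_inter.2 ⟨h1, hv.1⟩)
    exact (Finset.mem_inter.1 (bX (a + 1) (by omega) (Finset.mem_inter.2 ⟨h2, hv.1⟩))).1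

lemma mem_other {x w : ι} {v c : σ} (hd : ddist F x w = 1) (hv : v ∈ F x) (hvw : v ∉ F w)
    (hc : c ∈ F x) (hcv : c ≠ v) : c ∈ F w := by
  by_contra hcw
  unfold ddist at hd
  obtain ⟨u, hu⟩ := Finset.card_eq_one.1 hd
  have h1 : v ∈ F x \ F w := Finset.mem_sdiff.2 ⟨hv, hvw⟩
  have h2 : c ∈ F x \ F w := Finset.mem_sdiff.2 ⟨hc, hcw⟩
  rw [hu, Finset.mem_singleton] at h1 h2
  exact hcv (h2.trans h1.symm)

lemma le_of_inter (h : GoodCplx F t) {X Y Z : ι} (hs : F Y ∩ F Z ⊆ F X) :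
    ddist F X Z ≤ ddist F Y Z := by
  have h1 := h.inter_card Y Z
  have h2 := h.inter_card X Z
  have : (F Y ∩ F Z).card ≤ (F X ∩ F Z).card :=
    Finset.card_le_card (fun v hv => Finset.mem_inter.2 ⟨hs hv, (Finset.mem_inter.1 hv).2⟩)
  omega

lemma not_three (h : GoodCplx F t) {X Y Z : ι} {a b c : σ}
    (hXY : X ≠ Y) (hXZ : X ≠ Z) (hYZ : Y ≠ Z)
    (a1 : a ∈ F Y) (a2 : a ∈ F Z) (a3 : a ∉ F X)
    (b1 : b ∈ F X) (b2 : b ∈ F Z) (b3 : b ∉ F Y)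
    (c1 : c ∈ F X) (c2 : c ∈ F Y) (c3 : c ∉ F Z) : False := by
  rcases h.three hXY hXZ hYZ with hh | hh | hh
  · exact c3 (hh (Finset.mem_inter.2 ⟨c1, c2⟩))
  · exact b3 (hh (Finset.mem_inter.2 ⟨b1, b2⟩))
  · exact a3 (hh (Finset.mem_inter.2 ⟨a1, a2⟩))

/-- the neighbours of the spine or of a whisker are spine or whisker -/
lemma A_spine [Fintype ι] (h : GoodCplx F t) (hE : IsSpine F E L)
    (hmax : ∀ p q, ddist F p q ≤ L) {X : ι} {i : ℕ} (hi : i ≤ L) (hX : ∀ i ≤ L, X ≠ E i)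
    (hd : ddist F (E i) X = 1) : ∃ a, a + 1 ≤ L ∧ F (E a) ∩ F (E (a + 1)) ⊆ F X := by
  have hL : 1 ≤ L := hd ▸ hmax (E i) X
  by_cases hi0 : i = 0
  · subst hi0
    refine ⟨0, hL, ?_⟩
    have h1 := hE 0 L (by omega) le_rfl
    have h2 := hE 1 L (by omega) le_rfl
    have h3 := hE 0 1 (by omega) hL
    have := h.unique_ridge (Z := E L) (X := E 0) (Y := E 1) (Y' := X)
      (ne_of_pos (F := F) (by omega)) h3 hd (by omega) (by have := hmax X (E L); omega)
    rw [show 0 + 1 = 1 from rfl, this]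
    exact Finset.inter_subset_right
  by_cases hiL : i = L
  · subst hiL
    obtain ⟨a, rfl⟩ : ∃ a, i = a + 1 := ⟨i - 1, by omega⟩
    refine ⟨a, le_rfl, ?_⟩
    have h1 := hE 0 (a + 1) (by omega) le_rfl
    have h2 := hE 0 a (by omega) (by omega)
    have h3 := hE a (a + 1) (by omega) le_rfl
    rw [h.comm] at h1 h2 h3
    have := h.unique_ridge (Z := E 0) (X := E (a + 1)) (Y := E a) (Y' := X)
      (ne_of_pos (F := F) (by omega)) (by omega) hd (by omega) (by have := hmax X (E 0); omega)
    rw [Finset.inter_comm, this]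
    exact Finset.inter_subset_right
  obtain ⟨a, rfl⟩ : ∃ a, i = a + 1 := ⟨i - 1, by omega⟩
  by_contra hno
  push Not at hno
  obtain ⟨v, hv, hvX⟩ := Finset.not_subset.1 (hno (a + 1) (by omega))
  obtain ⟨u, hu, huX⟩ := Finset.not_subset.1 (hno a (by omega))
  rw [Finset.mem_inter] at hv hu
  have huv : u = v := by
    by_contra hne
    exact huX (mem_other hd hv.1 hvX hu.2 hne)
  subst huv
  obtain ⟨b, hb, hb'⟩ := Finset.not_subset.1
    (h.sp_left hE (i := a) (j := a + 1) (k := a + 2) (by omega) (by omega) (by omega))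
  obtain ⟨c, hc, hc'⟩ := Finset.not_subset.1
    (h.sp_right hE (i := a) (j := a + 1) (k := a + 2) (by omega) (by omega) (by omega))
  rw [Finset.mem_inter] at hb hc
  refine h.not_three (hX a (by omega)) (hX (a + 2) (by omega))
    (ne_of_pos (F := F) (by rw [hE _ _ (by omega) (by omega)]; omega)) hu.1 hv.2 huX
    (mem_other hd hv.1 hvX hb.1 ?_) hb.2 hb' (mem_other hd hv.1 hvX hc.2 ?_) hc.1 hc'
  · rintro rfl; exact hb' hu.1
  · rintro rfl; exact hc' hv.2

lemma A_whisker [Fintype ι] (h : GoodCplx F t) (hE : IsSpine F E L)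
    (hmax : ∀ p q, ddist F p q ≤ L) {X Y : ι} {a : ℕ} (ha : a + 1 ≤ L)
    (hs : F (E a) ∩ F (E (a + 1)) ⊆ F Y) (hY : ∀ i ≤ L, Y ≠ E i)
    (hX : ∀ i ≤ L, X ≠ E i)
    (hd : ddist F Y X = 1) : F (E a) ∩ F (E (a + 1)) ⊆ F X := by
  have hd1 : ddist F (E a) (E (a + 1)) = 1 := by rw [hE _ _ (by omega) ha]; omega
  have e1 := h.inter_eq_of_subset hd1 hs (hY a (by omega))
  have e2 := h.inter_eq_of_subset (by rw [h.comm]; exact hd1)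
    (by rw [Finset.inter_comm]; exact hs) (hY (a + 1) ha)
  rw [Finset.inter_comm (F (E (a + 1)))] at e2
  have bY : ∀ i ≤ L, F Y ∩ F (E i) ⊆ F (E a) ∩ F (E (a + 1)) := fun i hi => h.B1 hE (by omega) hs hY (i := i) hi
  have dR := h.inter_card (E a) (E (a + 1))
  have dY1 : ddist F Y (E a) = 1 := by
    have := h.inter_card Y (E a)
    rw [e1] at this; omega
  have dY2 : ddist F Y (E (a + 1)) = 1 := by
    have := h.inter_card Y (E (a + 1))
    rw [e2] at this; omega
  -- key step, towards the left
  have left : ∀ i ≤ a, ddist F X (E i) ≤ ddist F Y (E i) → F (E a) ∩ F (E (a + 1)) ⊆ F X := by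
    intro i hi hle
    have hle2 : ddist F (E a) (E i) ≤ ddist F Y (E i) := h.le_of_inter (by
      intro v hv
      exact (Finset.mem_inter.1 (bY i (by omega) hv)).1)
    have := h.unique_ridge (hY i (by omega)) dY1 hd hle2 hle
    rw [← e1, this]
    exact Finset.inter_subset_right
  have right : ∀ i ≤ L, a + 1 ≤ i → ddist F X (E i) ≤ ddist F Y (E i) →
      F (E a) ∩ F (E (a + 1)) ⊆ F X := by
    intro i hi hi' hle
    have hle2 : ddist F (E (a + 1)) (E i) ≤ ddist F Y (E i) := h.le_of_inter (by
      intro v hv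
      exact (Finset.mem_inter.1 (bY i (by omega) hv)).2)
    have := h.unique_ridge (hY i (by omega)) dY2 hd hle2 hle
    rw [← e2, this]
    exact Finset.inter_subset_right
  by_cases ha0 : a = 0
  · refine right L le_rfl ha ((hmax _ _).trans ?_)
    have : ddist F (E a) (E L) ≤ ddist F Y (E L) := h.le_of_inter (by
      intro v hv
      exact (Finset.mem_inter.1 (bY L le_rfl hv)).1)
    rw [hE a L (by omega) le_rfl] at this
    omega
  by_cases haL : a + 1 = L
  · refine left 0 (by omega) ((hmax _ _).trans ?_)
    have : ddist F (E (a + 1)) (E 0) ≤ ddist F Y (E 0) := h.le_of_inter (by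
      intro v hv
      exact (Finset.mem_inter.1 (bY 0 (by omega) hv)).2)
    rw [h.comm, hE 0 (a + 1) (by omega) ha] at this
    omega
  obtain ⟨a, rfl⟩ : ∃ a', a = a' + 1 := ⟨a - 1, by omega⟩
  by_contra hno
  obtain ⟨v, hv, hvX⟩ := Finset.not_subset.1 hno
  have hvY := hs hv
  have oth : ∀ c ∈ F Y, c ≠ v → c ∈ F X := fun c hc hcv => mem_other hd hvY hvX hc hcv
  by_cases v1 : v ∈ F (E a)
  swap
  · refine hno (left a (by omega) (h.le_of_inter ?_))
    intro c hc
    rw [Finset.mem_inter] at hc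
    exact oth c hc.1 (by rintro rfl; exact v1 hc.2)
  by_cases v2 : v ∈ F (E (a + 3))
  swap
  · refine hno (right (a + 3) (by omega) (by omega) (h.le_of_inter ?_))
    intro c hc
    rw [Finset.mem_inter] at hc
    exact oth c hc.1 (by rintro rfl; exact v2 hc.2)
  obtain ⟨b, hb, hb'⟩ := Finset.not_subset.1
    (h.sp_left hE (i := a) (j := a + 1) (k := a + 3) (by omega) (by omega) (by omega))
  obtain ⟨c, hc, hc'⟩ := Finset.not_subset.1
    (h.sp_right hE (i := a) (j := a + 2) (k := a + 3) (by omega) (by omega) (by omega))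
  have hb2 := sp_nested hE (i := a + 1) (j := a + 2) (k := a + 3) (by omega) (by omega) (by omega) hb
  have hc2 := sp_nested hE (i := a) (j := a + 1) (k := a + 2) (by omega) (by omega) (by omega) hc
  rw [Finset.mem_inter] at hb hc
  refine h.not_three (hX a (by omega)) (hX (a + 3) (by omega))
    (ne_of_pos (F := F) (by rw [hE _ _ (by omega) (by omega)]; omega)) v1 v2 hvX
    (oth b (hs (Finset.mem_inter.2 ⟨hb.1, hb2⟩)) ?_) hb.2 hb'
    (oth c (hs (Finset.mem_inter.2 ⟨hc2, hc.2⟩)) ?_) hc.1 hc'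
  · rintro rfl; exact hb' v1
  · rintro rfl; exact hc' v2

lemma A_all [Fintype ι] (h : GoodCplx F t) (hE : IsSpine F E L)
    (hmax : ∀ p q, ddist F p q ≤ L) (n : ℕ) : ∀ X, ddist F X (E 0) = n →
    (∃ i ≤ L, X = E i) ∨ ((∀ i ≤ L, X ≠ E i) ∧
      ∃ a, a + 1 ≤ L ∧ F (E a) ∩ F (E (a + 1)) ⊆ F X) := by
  induction n with
  | zero =>
    intro X hX
    left
    refine ⟨0, by omega, ?_⟩
    by_contra hne
    have := h.pos hne
    omega
  | succ n ih =>
    intro X hX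
    by_cases hsp : ∃ i ≤ L, X = E i
    · exact Or.inl hsp
    push Not at hsp
    refine Or.inr ⟨hsp, ?_⟩
    obtain ⟨Y, hY1, hY2⟩ := h.step n X (E 0) hX
    rw [h.comm] at hY1
    rcases ih Y hY2 with ⟨i, hi, rfl⟩ | ⟨hYs, a, ha, hs⟩
    · exact h.A_spine hE hmax hi hsp hY1
    · exact ⟨a, ha, h.A_whisker hE hmax ha hs hYs hsp hY1⟩

lemma main_inter (h : GoodCplx F t) (hE : IsSpine F E L) (lo hi : ι → ℕ)
    (hhi : ∀ X, hi X ≤ L) (hsub : ∀ X, F (E (lo X)) ∩ F (E (hi X)) ⊆ F X)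
    (hcase : ∀ X, (lo X = hi X ∧ X = E (lo X)) ∨ (hi X = lo X + 1 ∧ ∀ i ≤ L, X ≠ E i))
    {X Y : ι} (hXY : X ≠ Y) (hle : lo X + hi X ≤ lo Y + hi Y) :
    F X ∩ F Y = F (E (lo X)) ∩ F (E (hi Y)) := by
  have hX := hcase X
  have hY := hcase Y
  have hX2 := hhi X
  have hY2 := hhi Y
  have sX := hsub X
  have sY := hsub Y
  apply Finset.Subset.antisymm
  · rcases hX with ⟨x1, x2⟩ | ⟨x1, x2⟩ <;> rcases hY with ⟨y1, y2⟩ | ⟨y1, y2⟩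
    · conv_lhs => rw [x2, y2]
      rw [y1]
    · rw [y1] at sY
      have := h.B1 hE (by omega) sY y2 (i := lo X) (by omega)
      rw [← x2] at this
      intro v hv
      have := this (by rw [Finset.inter_comm]; exact hv)
      rw [← x2, y1]
      simp only [Finset.mem_inter] at *
      tauto
    · rw [x1] at sX
      have := h.B1 hE (by omega) sX x2 (i := lo Y) (by omega)
      rw [← y2] at this
      intro v hv
      have := this hv
      rw [← y1, ← y2]
      simp only [Finset.mem_inter] at *
      tauto
    · rw [x1] at sX
      rw [y1] at sY
      rw [y1]
      exact h.B2 hE (by omega) (by omega) sX x2 sY y2 hXY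
  · intro v hv
    have nest : ∀ j, lo X ≤ j → j ≤ hi Y → v ∈ F (E j) := fun j h1 h2 =>
      sp_nested hE h1 h2 (by omega) hv
    have hlt : lo X ≤ lo Y ∧ hi X ≤ hi Y := by omega
    refine Finset.mem_inter.2 ⟨sX (Finset.mem_inter.2 ⟨nest _ ?_ ?_, nest _ ?_ ?_⟩),
      sY (Finset.mem_inter.2 ⟨nest _ ?_ ?_, nest _ ?_ ?_⟩)⟩ <;> omega

end GoodCplx

lemma good_ordering {σ : Type} [DecidableEq σ] {r t : ℕ} (F : Fin r → Finset σ)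
    (h : GoodCplx F t) : ∃ g : Equiv.Perm (Fin r),
      (∀ i j l : Fin r, j < i → l < i →
        (F (g j) ∩ F (g i) ⊆ F (g l) ∩ F (g i) ∨
          F (g l) ∩ F (g i) ⊆ F (g j) ∩ F (g i))) ∧
      (∀ i : Fin r, ∀ hi : i.val + 1 < r,
        (F (g i) ∩ F (g ⟨i.val + 1, hi⟩)).card + 1 = (F (g ⟨i.val + 1, hi⟩)).card) := by
  rcases Nat.eq_zero_or_pos r with rfl | hr
  · exact ⟨1, fun i => i.elim0, fun i => i.elim0⟩
  have : Nonempty (Fin r) := ⟨⟨0, hr⟩⟩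
  obtain ⟨⟨G, H⟩, hGH⟩ := Finite.exists_max (fun p : Fin r × Fin r => ddist F p.1 p.2)
  have hmax : ∀ p q, ddist F p q ≤ ddist F G H := fun p q => hGH (p, q)
  generalize hL : ddist F G H = L at hmax
  obtain ⟨E, -, -, hE⟩ := h.exists_geodesic L G H hL
  have hE : IsSpine F E L := hE
  have hex : ∀ X, ∃ lo hi : ℕ, hi ≤ L ∧ F (E lo) ∩ F (E hi) ⊆ F X ∧
      ((lo = hi ∧ X = E lo) ∨ (hi = lo + 1 ∧ ∀ i ≤ L, X ≠ E i)) := by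
    intro X
    rcases h.A_all hE hmax _ X rfl with ⟨i, hi, rfl⟩ | ⟨h1, a, ha, hs⟩
    · exact ⟨i, i, hi, by simp, Or.inl ⟨rfl, rfl⟩⟩
    · exact ⟨a, a + 1, ha, hs, Or.inr ⟨rfl, h1⟩⟩
  choose lo hi hhi hsub hcase using hex
  have hmain := fun {X Y : Fin r} => h.main_inter hE lo hi hhi hsub hcase (X := X) (Y := Y)
  let κ : Fin r → ℕ := fun X => lo X + hi X
  have hmono : Monotone (κ ∘ Tuple.sort κ) := Tuple.monotone_sort κ
  generalize Tuple.sort κ = g at hmono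
  refine ⟨g, ?_, ?_⟩
  · intro i j l hji hli
    have hj := hmain (g.injective.ne hji.ne) (hmono hji.le)
    have hl := hmain (g.injective.ne hli.ne) (hmono hli.le)
    have kj : lo (g j) + hi (g j) ≤ lo (g i) + hi (g i) := hmono hji.le
    have kl : lo (g l) + hi (g l) ≤ lo (g i) + hi (g i) := hmono hli.le
    have cj := hcase (g j)
    have cl := hcase (g l)
    have ci := hcase (g i)
    rw [hj, hl]
    rcases le_total (lo (g j)) (lo (g l)) with hc | hc
    · left
      exact Finset.subset_inter (GoodCplx.sp_nested hE hc (by omega) (hhi _)) Finset.inter_subset_right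
    · right
      exact Finset.subset_inter (GoodCplx.sp_nested hE hc (by omega) (hhi _)) Finset.inter_subset_right
  · intro i hi'
    generalize hi2 : (⟨i.val + 1, hi'⟩ : Fin r) = j
    have hij : i < j := by rw [← hi2]; exact Fin.lt_def.2 (Nat.lt_succ_self _)
    have hne : g i ≠ g j := g.injective.ne hij.ne
    have hj := hmain hne (hmono hij.le)
    have k : lo (g i) + hi (g i) ≤ lo (g j) + hi (g j) := hmono hij.le
    have ci := hcase (g i)
    have cj := hcase (g j)
    have hij2 : hi (g j) = lo (g i) + 1 := by
      rcases lt_trichotomy (hi (g j)) (lo (g i) + 1) with hlt | heq | hgt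
      · exfalso
        apply hne
        rcases ci with ⟨c1, c2⟩ | ⟨c1, c2⟩ <;> rcases cj with ⟨d1, d2⟩ | ⟨d1, d2⟩
        · rw [c2, d2]; congr 1; omega
        all_goals omega
      · exact heq
      · exfalso
        have hm := hhi (g j)
        -- the spine element strictly in between
        obtain ⟨m, hm'⟩ := g.surjective (E (lo (g i) + 1))
        have hc := hcase (g m)
        have hk : lo (g m) = lo (g i) + 1 ∧ hi (g m) = lo (g i) + 1 := by
          rcases hc with ⟨c1, c2⟩ | ⟨c1, c2⟩
          · rw [hm'] at c2
            have : lo (g m) = lo (g i) + 1 := by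
              rw [← hm'] at c2
              have hb := hhi (g m)
              by_contra hne'
              rcases lt_or_gt_of_ne hne' with hl | hl
              · have := hE (lo (g m)) (lo (g i) + 1) hl.le (by omega)
                rw [← hm'] at this
                have e : E (lo (g m)) = g m := c2.symm
                rw [e, GoodCplx.self] at this
                omega
              · have := hE (lo (g i) + 1) (lo (g m)) hl.le (by omega)
                rw [← hm'] at this
                have e : E (lo (g m)) = g m := c2.symm
                rw [e, GoodCplx.self] at this
                omega
            omega
          · exact absurd hm' (c2 _ (by omega))
        have h1 : i < m := by
          by_contra hmi
          have : lo (g m) + hi (g m) ≤ lo (g i) + hi (g i) := hmono (not_lt.1 hmi)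
          omega
        have h2 : m < j := by
          by_contra hmi
          have : lo (g j) + hi (g j) ≤ lo (g m) + hi (g m) := hmono (not_lt.1 hmi)
          omega
        rw [← hi2] at h2
        rw [Fin.lt_def] at h1 h2
        simp only at h2
        omega
    rw [hj, hij2, h.card]
    have := h.inter_card (E (lo (g i))) (E (lo (g i) + 1))
    rw [hE _ _ (by omega) (by have := hhi (g j); omega)] at this
    omega

section Alg

open MvPolynomial

variable {k σ : Type} [Field k]

lemma hcomp_mul (p q : MvPolynomial σ k) {e : ℕ} (hq : q.IsHomogeneous e) (m : ℕ) :
    homogeneousComponent (m + e) (p * q) = homogeneousComponent m p * q := by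
  induction p using MvPolynomial.induction_on' with
  | monomial u a =>
    have h1 : (monomial u a : MvPolynomial σ k).IsHomogeneous u.degree := isHomogeneous_monomial a rfl
    rw [homogeneousComponent_of_mem (h1.mul hq), homogeneousComponent_of_mem h1]
    by_cases h : m = u.degree
    · simp [h]
    · simp [h]
  | add p p' h1 h2 => rw [add_mul, map_add, map_add, h1, h2, add_mul]

lemma hcomp_mul_lt (p q : MvPolynomial σ k) {e : ℕ} (hq : q.IsHomogeneous e) (m : ℕ) (hm : m < e) :
    homogeneousComponent m (p * q) = 0 := by
  induction p using MvPolynomial.induction_on' with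
  | monomial u a =>
    have h1 : (monomial u a : MvPolynomial σ k).IsHomogeneous u.degree := isHomogeneous_monomial a rfl
    rw [homogeneousComponent_of_mem (h1.mul hq), if_neg (by omega)]
  | add p p' h1 h2 => rw [add_mul, map_add, h1, h2, add_zero]

/-- homogeneous vectors of a graded free module -/
def IsHomV {b : ℕ} (deg : Fin b → ℕ) (n : ℕ) (v : Fin b → MvPolynomial σ k) : Prop :=
  ∀ l, (v l).IsHomogeneous (n - deg l) ∧ (n < deg l → v l = 0)

/-- homogeneous components of vectors -/
noncomputable def compV {b : ℕ} (deg : Fin b → ℕ) (n : ℕ) (v : Fin b → MvPolynomial σ k) :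
    Fin b → MvPolynomial σ k :=
  fun l => if deg l ≤ n then homogeneousComponent (n - deg l) (v l) else 0

lemma isHomV_compV {b : ℕ} (deg : Fin b → ℕ) (n : ℕ) (v : Fin b → MvPolynomial σ k) :
    IsHomV deg n (compV deg n v) := by
  intro l
  unfold compV
  split_ifs with h
  · exact ⟨homogeneousComponent_isHomogeneous _ _, fun hh => by omega⟩
  · exact ⟨isHomogeneous_zero _ _ _, fun _ => rfl⟩

lemma sum_compV {b : ℕ} (deg : Fin b → ℕ) (v : Fin b → MvPolynomial σ k) :
    ∃ M : ℕ, ∑ n ∈ Finset.range M, compV deg n v = v := by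
  refine ⟨∑ l, (deg l + (v l).totalDegree) + 1, ?_⟩
  funext l
  have hM : deg l + (v l).totalDegree < ∑ l, (deg l + (v l).totalDegree) + 1 :=
    Nat.lt_succ_of_le (Finset.single_le_sum (f := fun l => deg l + (v l).totalDegree)
      (fun _ _ => Nat.zero_le _) (Finset.mem_univ l))
  generalize ∑ l, (deg l + (v l).totalDegree) + 1 = M at hM
  rw [Finset.sum_apply]
  ext d
  rw [coeff_sum]
  have : ∀ n ∈ Finset.range M, coeff d (compV deg n v l) =
      if n = deg l + d.degree then coeff d (v l) else 0 := by
    intro n _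
    unfold compV
    split_ifs with h1 h2 h2
    · rw [coeff_homogeneousComponent, if_pos (by omega)]
    · rw [coeff_homogeneousComponent, if_neg (by omega)]
    · omega
    · simp
  rw [Finset.sum_congr rfl this, Finset.sum_ite_eq']
  split_ifs with h
  · rfl
  · by_contra hne
    have hd : d ∈ (v l).support := by
      rw [mem_support_iff]; exact fun hh => hne hh.symm
    have := le_totalDegree hd
    have h3 : d.degree = d.sum fun _ e => e := rfl
    rw [Finset.mem_range] at h
    omega

lemma lincomb_compV {b b' : ℕ} (deg : Fin b → ℕ) (deg' : Fin b' → ℕ)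
    (v : Fin b' → Fin b → MvPolynomial σ k) (hv : ∀ j, IsHomV deg (deg' j) (v j)) (n : ℕ)
    (s : Fin b' → MvPolynomial σ k) :
    Fintype.linearCombination (MvPolynomial σ k) v (compV deg' n s) =
      compV deg n (Fintype.linearCombination (MvPolynomial σ k) v s) := by
  funext l
  rw [Fintype.linearCombination_apply, Fintype.linearCombination_apply]
  unfold compV
  simp only [Finset.sum_apply, Pi.smul_apply, smul_eq_mul]
  rw [map_sum]
  have : (if deg l ≤ n then ∑ j, homogeneousComponent (n - deg l) (s j * v j l) else 0) =
      ∑ j, if deg l ≤ n then homogeneousComponent (n - deg l) (s j * v j l) else 0 := by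
    split_ifs <;> simp
  rw [this]
  refine Finset.sum_congr rfl fun j _ => ?_
  obtain ⟨h1, h2⟩ := hv j l
  by_cases hlt : deg' j < deg l
  · simp [h2 hlt]
  by_cases hn : deg' j ≤ n
  · rw [if_pos hn, if_pos (by omega), ← hcomp_mul _ _ h1]
    congr 2
    omega
  · rw [if_neg hn, zero_mul]
    split_ifs with hl
    · rw [hcomp_mul_lt _ _ h1 _ (by omega)]
    · rfl

/-- graded submodules -/
def GradedSub {b : ℕ} (deg : Fin b → ℕ)
    (N : Submodule (MvPolynomial σ k) (Fin b → MvPolynomial σ k)) : Prop :=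
  ∀ v ∈ N, ∀ n, compV deg n v ∈ N

lemma compV_zero {b : ℕ} (deg : Fin b → ℕ) (n : ℕ) :
    compV deg n (0 : Fin b → MvPolynomial σ k) = 0 := by
  funext l; simp [compV]

lemma ker_graded {b b' : ℕ} (deg : Fin b → ℕ) (deg' : Fin b' → ℕ)
    (v : Fin b' → Fin b → MvPolynomial σ k) (hv : ∀ j, IsHomV deg (deg' j) (v j)) :
    GradedSub deg' (LinearMap.ker (Fintype.linearCombination (MvPolynomial σ k) v)) := by
  intro s hs n
  rw [LinearMap.mem_ker] at hs ⊢
  rw [lincomb_compV deg deg' v hv, hs, compV_zero]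

/-- existence of finite homogeneous generating systems -/
lemma exists_hom_gens [Finite σ] {b : ℕ} (deg : Fin b → ℕ)
    (N : Submodule (MvPolynomial σ k) (Fin b → MvPolynomial σ k)) (hN : GradedSub deg N) :
    ∃ b' : ℕ, ∃ (deg' : Fin b' → ℕ) (v : Fin b' → Fin b → MvPolynomial σ k),
      (∀ j, IsHomV deg (deg' j) (v j)) ∧ Submodule.span (MvPolynomial σ k) (Set.range v) = N := by
  have hspan : Submodule.span (MvPolynomial σ k) {w | w ∈ N ∧ ∃ n, IsHomV deg n w} = N := by
    apply le_antisymm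
    · rw [Submodule.span_le]
      exact fun w hw => hw.1
    · intro w hw
      obtain ⟨M, hM⟩ := sum_compV deg w
      rw [← hM]
      exact Submodule.sum_mem _ fun n _ => Submodule.subset_span ⟨hN w hw n, n, isHomV_compV _ _ _⟩
  have hfg : N.FG := IsNoetherian.noetherian N
  rw [← hspan, Submodule.fg_span_iff_fg_span_finset_subset] at hfg
  obtain ⟨T, hT, hT2⟩ := hfg
  have hdeg : ∀ j : Fin T.card, ∃ n, IsHomV deg n ((T.equivFin.symm j : T) : Fin b → MvPolynomial σ k) :=
    fun j => (hT (T.equivFin.symm j).2).2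
  choose deg' hdeg' using hdeg
  refine ⟨T.card, deg', fun j => (T.equivFin.symm j : T), hdeg', ?_⟩
  rw [← hspan, hT2]
  congr 1
  ext w
  simp only [Set.mem_range]
  constructor
  · rintro ⟨j, rfl⟩; exact (T.equivFin.symm j).2
  · intro hw; exact ⟨T.equivFin ⟨w, hw⟩, by simp⟩

/-- minimal homogeneous generating systems -/
lemma exists_min_gens [Finite σ] {b : ℕ} (deg : Fin b → ℕ)
    (N : Submodule (MvPolynomial σ k) (Fin b → MvPolynomial σ k)) (hN : GradedSub deg N) :
    ∃ b' : ℕ, ∃ (deg' : Fin b' → ℕ) (v : Fin b' → Fin b → MvPolynomial σ k),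
      (∀ j, IsHomV deg (deg' j) (v j)) ∧ Submodule.span (MvPolynomial σ k) (Set.range v) = N ∧
      ∀ s ∈ LinearMap.ker (Fintype.linearCombination (MvPolynomial σ k) v), ∀ l,
        constantCoeff (s l) = 0 := by
  classical
  have hex := exists_hom_gens deg N hN
  obtain ⟨deg', v, hv, hspan⟩ := Nat.find_spec hex
  have hmin := fun m hm => Nat.find_min hex (m := m) hm
  generalize Nat.find hex = b' at *
  refine ⟨b', deg', v, hv, hspan, ?_⟩
  intro s hs l
  by_contra hc
  cases b' with
  | zero => exact l.elim0
  | succ b' =>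
  have hs' := ker_graded deg deg' v hv s hs (deg' l)
  have hsl : compV deg' (deg' l) s l = C (constantCoeff (s l)) := by
    unfold compV
    rw [if_pos le_rfl, Nat.sub_self, homogeneousComponent_zero]
    rfl
  generalize compV deg' (deg' l) s = s' at hs' hsl
  rw [LinearMap.mem_ker, Fintype.linearCombination_apply, Fin.sum_univ_succAbove _ l, hsl] at hs'
  refine hmin b' (Nat.lt_succ_self _) ⟨deg' ∘ l.succAbove, v ∘ l.succAbove, fun j => hv _, ?_⟩
  apply le_antisymm
  · rw [← hspan]
    apply Submodule.span_mono
    rintro _ ⟨j, rfl⟩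
    exact ⟨_, rfl⟩
  · rw [← hspan, Submodule.span_le]
    have hother : ∀ j, v (l.succAbove j) ∈
        Submodule.span (MvPolynomial σ k) (Set.range (v ∘ l.succAbove)) :=
      fun j => Submodule.subset_span ⟨j, rfl⟩
    have hl : v l ∈ Submodule.span (MvPolynomial σ k) (Set.range (v ∘ l.succAbove)) := by
      have e : v l = (C (-(constantCoeff (s l))⁻¹) : MvPolynomial σ k) •
          ∑ i, s' (l.succAbove i) • v (l.succAbove i) := by
        rw [← neg_eq_iff_add_eq_zero] at hs'
        rw [← hs', smul_neg, ← mul_smul, map_neg, neg_mul, ← C_mul, inv_mul_cancel₀ hc]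
        simp
      rw [e]
      exact Submodule.smul_mem _ _ (Submodule.sum_mem _ fun i _ => Submodule.smul_mem _ _ (hother i))
    rintro _ ⟨j, rfl⟩
    rcases eq_or_ne j l with rfl | hj
    · exact hl
    · obtain ⟨i, rfl⟩ := Fin.exists_succAbove_eq hj
      exact hother i

end Alg

section Res

open MvPolynomial

/-- a graded submodule of a graded free module, contained in `m` times the module -/
structure ResState (k σ : Type) [Field k] where
  b : ℕ
  deg : Fin b → ℕ
  N : Submodule (MvPolynomial σ k) (Fin b → MvPolynomial σ k)
  graded : GradedSub deg N
  min : ∀ s ∈ N, ∀ l, constantCoeff (s l) = 0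

variable {k σ : Type} [Field k]

lemma ResState.exists_next [Finite σ] (S : ResState k σ) : ∃ (S' : ResState k σ)
    (d : (Fin S'.b → MvPolynomial σ k) →ₗ[MvPolynomial σ k] (Fin S.b → MvPolynomial σ k)),
    LinearMap.range d = S.N ∧ LinearMap.ker d = S'.N ∧
      ∀ j, IsHomV S.deg (S'.deg j) (d (Pi.single j 1)) := by
  obtain ⟨b', deg', v, hv, hspan, hmin⟩ := exists_min_gens S.deg S.N S.graded
  refine ⟨⟨b', deg', LinearMap.ker (Fintype.linearCombination (MvPolynomial σ k) v),
    ker_graded S.deg deg' v hv, hmin⟩, Fintype.linearCombination (MvPolynomial σ k) v, ?_, rfl, ?_⟩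
  · rw [Fintype.range_linearCombination, hspan]
  · intro j
    rw [Fintype.linearCombination_apply_single, one_smul]
    exact hv j

/-- the chain of states -/
noncomputable def resChain [Finite σ] (S : ResState k σ) : ℕ → ResState k σ
  | 0 => S
  | n + 1 => (resChain S n).exists_next.choose

/-- the differential -/
noncomputable def resD [Finite σ] (S : ResState k σ) (n : ℕ) :
    (Fin (resChain S (n + 1)).b → MvPolynomial σ k) →ₗ[MvPolynomial σ k]
      (Fin (resChain S n).b → MvPolynomial σ k) :=
  (resChain S n).exists_next.choose_spec.choose

lemma resD_spec [Finite σ] (S : ResState k σ) (n : ℕ) :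
    LinearMap.range (resD S n) = (resChain S n).N ∧
    LinearMap.ker (resD S n) = (resChain S (n + 1)).N ∧
    ∀ j, IsHomV (resChain S n).deg ((resChain S (n + 1)).deg j) (resD S n (Pi.single j 1)) :=
  (resChain S n).exists_next.choose_spec.choose_spec

/-- exponent vector of a set -/
noncomputable def expo (A : Finset σ) : σ →₀ ℕ := ∑ v ∈ A, Finsupp.single v 1

lemma prod_X_eq (A : Finset σ) :
    (∏ v ∈ A, (X v : MvPolynomial σ k)) = monomial (expo A) 1 := by
  classical
  unfold expo
  induction A using Finset.induction_on with
  | empty => simp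
  | insert a s ha ih =>
    rw [Finset.prod_insert ha, Finset.sum_insert ha, ih, X, monomial_mul, one_mul]

lemma expo_apply [DecidableEq σ] (A : Finset σ) (v : σ) : expo A v = if v ∈ A then 1 else 0 := by
  classical
  unfold expo
  rw [Finsupp.finsetSum_apply]
  simp [Finsupp.single_apply]

lemma expo_le_iff (A B : Finset σ) : expo A ≤ expo B ↔ A ⊆ B := by
  classical
  constructor
  · intro h v hv
    have := h v
    rw [expo_apply, expo_apply, if_pos hv] at this
    by_contra hb
    rw [if_neg hb] at this
    omega
  · intro h v
    rw [expo_apply, expo_apply]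
    split_ifs with h1 h2
    · exact le_rfl
    · exact absurd (h h1) h2
    · omega
    · exact le_rfl

lemma expo_degree (A : Finset σ) : (expo A).degree = A.card := by
  classical
  unfold expo
  rw [map_sum]
  simp

/-- the generators as vectors of length one -/
noncomputable def genV (k : Type) [Field k] {r : ℕ} (F : Fin r → Finset σ) :
    Fin r → Fin 1 → MvPolynomial σ k :=
  fun i _ => ∏ v ∈ F i, (X v : MvPolynomial σ k)

lemma genV_hom {r : ℕ} (F : Fin r → Finset σ) (j : Fin r) :
    IsHomV (fun _ : Fin 1 => 0) ((F j).card) (genV k F j) := by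
  intro l
  refine ⟨?_, fun h => absurd h (Nat.not_lt_zero _)⟩
  unfold genV
  rw [prod_X_eq]
  exact isHomogeneous_monomial _ (by rw [expo_degree]; rfl)

lemma genV_min {r : ℕ} (F : Fin r → Finset σ) (hfacet : ∀ i j, i ≠ j → ¬ F i ⊆ F j) :
    ∀ s ∈ LinearMap.ker (Fintype.linearCombination (MvPolynomial σ k) (genV k F)), ∀ l,
      constantCoeff (s l) = 0 := by
  intro s hs l
  rw [LinearMap.mem_ker, Fintype.linearCombination_apply] at hs
  have h0 := congrFun hs 0
  rw [Finset.sum_apply] at h0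
  have h1 := congrArg (coeff (expo (F l))) h0
  rw [coeff_sum, Finset.sum_eq_single l] at h1
  · simp only [Pi.smul_apply, smul_eq_mul, genV, prod_X_eq] at h1
    rw [coeff_mul_monomial', if_pos le_rfl] at h1
    rw [constantCoeff_eq]
    simpa using h1
  · intro j _ hj
    simp only [Pi.smul_apply, smul_eq_mul, genV, prod_X_eq]
    rw [coeff_mul_monomial', if_neg]
    rw [expo_le_iff]
    exact hfacet j l hj
  · simp

/-- first state -/
noncomputable def firstState (k : Type) [Field k] {r : ℕ} (F : Fin r → Finset σ)
    (hfacet : ∀ i j, i ≠ j → ¬ F i ⊆ F j) : ResState k σ where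
  b := r
  deg := fun j => (F j).card
  N := LinearMap.ker (Fintype.linearCombination (MvPolynomial σ k) (genV k F))
  graded := ker_graded _ _ _ (genV_hom F)
  min := genV_min F hfacet

/-- the ranks -/
noncomputable def resB [Finite σ] (S : ResState k σ) : ℕ → ℕ
  | 0 => 1
  | n + 1 => (resChain S n).b

/-- the degrees -/
noncomputable def resDeg [Finite σ] (S : ResState k σ) : (n : ℕ) → Fin (resB S n) → ℕ
  | 0 => fun _ => 0
  | n + 1 => (resChain S n).deg

/-- all the differentials -/
noncomputable def resDiff [Finite σ] {r : ℕ} (F : Fin r → Finset σ)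
    (hfacet : ∀ i j, i ≠ j → ¬ F i ⊆ F j) : (i : ℕ) →
    ((Fin (resB (firstState k F hfacet) (i + 1)) → MvPolynomial σ k) →ₗ[MvPolynomial σ k]
        (Fin (resB (firstState k F hfacet) i) → MvPolynomial σ k))
  | 0 => Fintype.linearCombination (MvPolynomial σ k) (genV k F)
  | n + 1 => resD (firstState k F hfacet) n

lemma genV_single_hom {r : ℕ} (F : Fin r → Finset σ) (j : Fin r) :
    IsHomV (fun _ : Fin 1 => 0) ((F j).card)
      (Fintype.linearCombination (MvPolynomial σ k) (genV k F) (Pi.single j 1)) := by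
  rw [Fintype.linearCombination_apply_single, one_smul]
  exact genV_hom F j

lemma genV_single_const {r : ℕ} (F : Fin r → Finset σ) (hne : ∀ i, (F i).Nonempty)
    (j : Fin r) (l : Fin 1) :
    constantCoeff (Fintype.linearCombination (MvPolynomial σ k) (genV k F)
      (Pi.single j 1) l) = 0 := by
  rw [Fintype.linearCombination_apply_single, one_smul]
  unfold genV
  rw [map_prod]
  obtain ⟨v, hv⟩ := hne j
  exact Finset.prod_eq_zero hv (by simp)

/-- the minimal resolution -/
noncomputable def theRes [Finite σ] {r : ℕ} (F : Fin r → Finset σ)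
    (hne : ∀ i, (F i).Nonempty)
    (hfacet : ∀ i j, i ≠ j → ¬ F i ⊆ F j) : MinFreeRes k σ
      (Ideal.span (Set.range fun i => ∏ v ∈ F i, (X v : MvPolynomial σ k))) where
  b := resB (firstState k F hfacet)
  deg := resDeg (firstState k F hfacet)
  d := resDiff F hfacet
  aug := (Ideal.span (Set.range fun i => ∏ v ∈ F i, (X v : MvPolynomial σ k))).mkQ ∘ₗ
    (LinearMap.proj (0 : Fin 1) : (Fin 1 → MvPolynomial σ k) →ₗ[MvPolynomial σ k] MvPolynomial σ k)
  aug_surjective := by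
    intro y
    obtain ⟨x, rfl⟩ := Submodule.mkQ_surjective _ y
    exact ⟨fun _ => x, rfl⟩
  exact_zero := by
    intro (y : Fin 1 → MvPolynomial σ k)
    change (Ideal.span (Set.range fun i => ∏ v ∈ F i, (X v : MvPolynomial σ k))).mkQ (y 0) = 0 ↔
      y ∈ Set.range (Fintype.linearCombination (MvPolynomial σ k) (genV k F))
    rw [Submodule.mkQ_apply, Submodule.Quotient.mk_eq_zero]
    change y 0 ∈ Submodule.span _ _ ↔ _
    rw [← Fintype.range_linearCombination]
    simp only [LinearMap.mem_range, Set.mem_range]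
    refine exists_congr fun s => ?_
    rw [Fintype.linearCombination_apply, Fintype.linearCombination_apply]
    constructor
    · intro h
      funext l
      rw [Subsingleton.elim l 0, Finset.sum_apply, ← h]
      rfl
    · intro h
      rw [← h, Finset.sum_apply]
      rfl
  exact_succ := by
    intro i y
    cases i with
    | zero =>
      have h := (resD_spec (firstState k F hfacet) 0).1
      have : y ∈ LinearMap.ker (Fintype.linearCombination (MvPolynomial σ k) (genV k F)) ↔
        y ∈ LinearMap.range (resD (firstState k F hfacet) 0) := by rw [h]; rfl
      exact this
    | succ n =>
      have h := (resD_spec (firstState k F hfacet) (n + 1)).1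
      have h' := (resD_spec (firstState k F hfacet) n).2.1
      have : y ∈ LinearMap.ker (resD (firstState k F hfacet) n) ↔
        y ∈ LinearMap.range (resD (firstState k F hfacet) (n + 1)) := by rw [h, h']
      exact this
  aug_homog := by
    intro j
    refine ⟨1, isHomogeneous_one _ _, ?_⟩
    have hj : j = (0 : Fin 1) := Subsingleton.elim (α := Fin 1) j 0
    subst hj
    rfl
  d_homog := by
    intro i j l
    cases i with
    | zero =>
      exact genV_single_hom F j l
    | succ n => exact (resD_spec (firstState k F hfacet) n).2.2 j l
  minimal := by
    intro i j l
    cases i with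
    | zero =>
      exact genV_single_const F hne j l
    | succ n =>
      refine (resChain (firstState k F hfacet) n).min _ ?_ l
      rw [← (resD_spec (firstState k F hfacet) n).1]
      exact LinearMap.mem_range_self _ _

/-- consequences of the linear resolution -/
lemma linear_conseq [Finite σ] {r : ℕ} (F : Fin r → Finset σ)
    (hne : ∀ i, (F i).Nonempty)
    (hfacet : ∀ i j, i ≠ j → ¬ F i ⊆ F j)
    (hlin : HasLinearResolution k σ
      (Ideal.span (Set.range fun i => ∏ v ∈ F i, (X v : MvPolynomial σ k)))) :
    ∃ t : ℕ, (∀ i, (F i).card = t) ∧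
      ∃ (m : ℕ) (w : Fin m → Fin r → MvPolynomial σ k),
        (∀ j i, (w j i).IsHomogeneous 1) ∧
        (∀ j, ∑ i, w j i * ∏ v ∈ F i, X v = 0) ∧
        (∀ s : Fin r → MvPolynomial σ k, ∑ i, s i * ∏ v ∈ F i, X v = 0 →
          ∃ c : Fin m → MvPolynomial σ k, ∀ i, s i = ∑ j, c j * w j i) := by
  obtain ⟨t, ht⟩ := hlin
  have h1 : ∀ i, (F i).card = t := fun i => ht (theRes F hne hfacet) 0 i
  refine ⟨t, h1, ?_⟩
  have h2 : ∀ j, (resChain (firstState k F hfacet) 1).deg j = t + 1 :=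
    fun j => ht (theRes F hne hfacet) 1 j
  have hs := resD_spec (firstState k F hfacet) 0
  have kerd : ∀ s : Fin r → MvPolynomial σ k, ∑ i, s i * ∏ v ∈ F i, X v = 0 ↔
      s ∈ LinearMap.range (resD (firstState k F hfacet) 0) := by
    intro s
    rw [hs.1]
    change _ ↔ s ∈ LinearMap.ker (Fintype.linearCombination (MvPolynomial σ k) (genV k F))
    rw [LinearMap.mem_ker, Fintype.linearCombination_apply]
    constructor
    · intro h
      funext l
      rw [Finset.sum_apply]
      exact h
    · intro h
      have := congrFun h 0
      rw [Finset.sum_apply] at this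
      exact this
  refine ⟨(resChain (firstState k F hfacet) 1).b,
    fun j => resD (firstState k F hfacet) 0 (Pi.single j 1), ?_, ?_, ?_⟩
  · intro j i
    have h3 := (hs.2.2 j i).1
    have h4 : (resChain (firstState k F hfacet) 0).deg i = t := h1 i
    have h5 : (resChain (firstState k F hfacet) (0 + 1)).deg j = t + 1 := h2 j
    have e : (resChain (firstState k F hfacet) (0 + 1)).deg j -
        (resChain (firstState k F hfacet) 0).deg i = 1 := by omega
    rw [e] at h3
    exact h3
  · intro j
    exact (kerd _).2 ⟨Pi.single j 1, rfl⟩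
  · intro s h
    obtain ⟨c, hc⟩ := (kerd s).1 h
    refine ⟨c, fun i => ?_⟩
    have e : c = ∑ j, c j • (Pi.single j 1 : Fin _ → MvPolynomial σ k) := by
      funext l
      simp [Finset.sum_apply, Pi.single_apply]
    rw [← hc]
    conv_lhs => rw [e, map_sum]
    refine (Finset.sum_apply _ _ _).trans ?_
    refine Finset.sum_congr rfl fun j _ => ?_
    rw [map_smul]
    rfl

end Res

section Conn

open MvPolynomial

variable {k σ : Type} [Field k]

/-- a nonzero term forces the exponent shape -/
lemma term_shape [DecidableEq σ] (A U : Finset σ) (m : σ →₀ ℕ) (c : k) (w : MvPolynomial σ k)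
    (hw : w.IsHomogeneous 1)
    (h : coeff (expo U) (monomial m c * w * ∏ v ∈ A, X v) ≠ 0) :
    m + expo A ≤ expo U ∧ ∃ u, expo U = m + expo A + Finsupp.single u 1 := by
  rw [prod_X_eq, coeff_mul_monomial'] at h
  split_ifs at h with h1
  · rw [coeff_monomial_mul', mul_one] at h
    split_ifs at h with h2
    · have h3 : coeff (expo U - expo A - m) w ≠ 0 := right_ne_zero_of_mul h
      have h4 : (expo U - expo A - m).degree = 1 := by
        by_contra hd
        exact h3 (hw.coeff_eq_zero hd)
      have h5 : expo U = m + expo A + (expo U - expo A - m) := by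
        ext v
        have a := h1 v
        have b := h2 v
        simp only [Finsupp.tsub_apply, Finsupp.add_apply] at *
        omega
      obtain ⟨u, hu⟩ := (Finsupp.sum_eq_one_iff _).1 h4
      refine ⟨?_, u, ?_⟩
      · rw [h5]; exact le_self_add
      · rw [← hu]; exact h5
    · simp at h
  · simp at h

lemma conn_claim [DecidableEq σ] {r : ℕ} (F : Fin r → Finset σ)
    (hfacet : ∀ i j, i ≠ j → ¬ F i ⊆ F j) (U : Finset σ) (C : Finset (Fin r))
    (hC : ∀ i j, i ∈ C → F i ⊆ U → F j ⊆ U → ddist F i j = 1 → j ∈ C)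
    (w : Fin r → MvPolynomial σ k) (hw : ∀ i, (w i).IsHomogeneous 1)
    (hsyz : ∑ i, w i * ∏ v ∈ F i, X v = 0) (p : MvPolynomial σ k) :
    coeff (expo U) (∑ i ∈ C, p * w i * ∏ v ∈ F i, X v) = 0 := by
  classical
  induction p using MvPolynomial.induction_on' with
  | add p q hp hq =>
    simp only [add_mul, Finset.sum_add_distrib, coeff_add, hp, hq, add_zero]
  | monomial m c =>
    by_cases hz : ∃ i ∈ C, coeff (expo U) (monomial m c * w i * ∏ v ∈ F i, X v) ≠ 0
    · obtain ⟨i, hi, hne⟩ := hz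
      obtain ⟨l1, u, hu⟩ := term_shape _ _ _ _ _ (hw i) hne
      have key : coeff (expo U) (∑ i ∈ C, monomial m c * w i * ∏ v ∈ F i, X v) =
          coeff (expo U) (∑ i, monomial m c * w i * ∏ v ∈ F i, X v) := by
        rw [coeff_sum, coeff_sum]
        refine Finset.sum_subset (Finset.subset_univ _) ?_
        intro j _ hj
        by_contra hjn
        obtain ⟨l2, u2, hu2⟩ := term_shape _ _ _ _ _ (hw j) hjn
        apply hj
        have s1 : F i ⊆ U := (expo_le_iff _ _).1 (le_trans le_add_self l1)
        have s2 : F j ⊆ U := (expo_le_iff _ _).1 (le_trans le_add_self l2)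
        by_cases hij : i = j
        · exact hij ▸ hi
        refine hC i j hi s1 s2 ?_
        have hsub : F i \ F j ⊆ {u2} := by
          intro v hv
          rw [Finset.mem_sdiff] at hv
          have a := DFunLike.congr_fun hu v
          have b := DFunLike.congr_fun hu2 v
          simp only [Finsupp.add_apply, expo_apply, if_pos hv.1, if_neg hv.2,
            Finsupp.single_apply] at a b
          rw [Finset.mem_singleton]
          by_contra hne2
          rw [if_neg (fun h : u2 = v => hne2 h.symm)] at b
          rw [if_pos (s1 hv.1)] at a b
          omega
        have hc := Finset.card_le_card hsub
        rw [Finset.card_singleton] at hc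
        have hpos : 0 < (F i \ F j).card := by
          rw [Finset.card_pos, Finset.sdiff_nonempty]
          exact hfacet i j hij
        unfold ddist
        omega
      rw [key]
      simp only [mul_assoc]
      rw [← Finset.mul_sum, hsyz, mul_zero, coeff_zero]
    · push Not at hz
      rw [coeff_sum]
      exact Finset.sum_eq_zero hz

lemma conn_of_syz [DecidableEq σ] {r m : ℕ} (F : Fin r → Finset σ)
    (hfacet : ∀ i j, i ≠ j → ¬ F i ⊆ F j)
    (w : Fin m → Fin r → MvPolynomial σ k)
    (hw : ∀ j i, (w j i).IsHomogeneous 1)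
    (hsyz : ∀ j, ∑ i, w j i * ∏ v ∈ F i, X v = 0)
    (hgen : ∀ s : Fin r → MvPolynomial σ k, ∑ i, s i * ∏ v ∈ F i, X v = 0 →
          ∃ c : Fin m → MvPolynomial σ k, ∀ i, s i = ∑ j, c j * w j i) (G H : Fin r) :
    Relation.ReflTransGen
      (fun p q => F p ⊆ F G ∪ F H ∧ F q ⊆ F G ∪ F H ∧ ddist F p q = 1) G H := by
  classical
  set Rel : Fin r → Fin r → Prop :=
    fun p q => F p ⊆ F G ∪ F H ∧ F q ⊆ F G ∪ F H ∧ ddist F p q = 1 with hRel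
  by_contra hn
  set C : Finset (Fin r) := Finset.univ.filter (fun i => Relation.ReflTransGen Rel G i) with hCdef
  have hGC : G ∈ C := by simp [hCdef, Relation.ReflTransGen.refl]
  have hHC : H ∉ C := by simpa [hCdef] using hn
  have hGH : G ≠ H := fun h => hHC (h ▸ hGC)
  have hC : ∀ i j, i ∈ C → F i ⊆ F G ∪ F H → F j ⊆ F G ∪ F H → ddist F i j = 1 → j ∈ C := by
    intro i j hi h1 h2 h3
    simp only [hCdef, Finset.mem_filter, Finset.mem_univ, true_and] at hi ⊢
    exact hi.tail ⟨h1, h2, h3⟩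
  have hU : (∏ v ∈ F H \ F G, (X v : MvPolynomial σ k)) * ∏ v ∈ F G, X v =
      ∏ v ∈ F G ∪ F H, X v := by
    rw [← Finset.prod_union Finset.sdiff_disjoint, Finset.sdiff_union_self_eq_union,
      Finset.union_comm]
  have hU2 : (∏ v ∈ F G \ F H, (X v : MvPolynomial σ k)) * ∏ v ∈ F H, X v =
      ∏ v ∈ F G ∪ F H, X v := by
    rw [← Finset.prod_union Finset.sdiff_disjoint, Finset.sdiff_union_self_eq_union]
  let s : Fin r → MvPolynomial σ k := fun i =>
    if i = G then ∏ v ∈ F H \ F G, X v else if i = H then - ∏ v ∈ F G \ F H, X v else 0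
  have hs : ∑ i, s i * ∏ v ∈ F i, X v = 0 := by
    rw [Finset.sum_eq_add_of_mem G H (Finset.mem_univ _) (Finset.mem_univ _) hGH]
    · simp only [s, if_true, if_neg hGH.symm, neg_mul]
      rw [hU, hU2, add_neg_cancel]
    · rintro i - ⟨h1, h2⟩
      simp [s, h1, h2]
  obtain ⟨c, hc⟩ := hgen s hs
  have e1 : coeff (expo (F G ∪ F H)) (∑ i ∈ C, s i * ∏ v ∈ F i, X v) = 1 := by
    rw [Finset.sum_eq_single G]
    · simp only [s, if_true]
      rw [hU, prod_X_eq, coeff_monomial, if_pos rfl]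
    · intro i hi h1
      have h2 : i ≠ H := fun h => hHC (h ▸ hi)
      simp [s, h1, h2]
    · exact fun h => absurd hGC h
  have e2 : ∑ i ∈ C, s i * ∏ v ∈ F i, X v =
      ∑ j, ∑ i ∈ C, c j * w j i * ∏ v ∈ F i, X v := by
    rw [Finset.sum_comm]
    refine Finset.sum_congr rfl fun i _ => ?_
    rw [hc i, Finset.sum_mul]
  rw [e2, coeff_sum, Finset.sum_eq_zero] at e1
  · exact zero_ne_one e1
  · intro j _
    exact conn_claim F hfacet _ C hC (w j) (hw j) (hsyz j) (c j)

end Conn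

/-- Lemma 2.1: if `Δ` is a simplicial tree (a connected simplicial forest: every
nonempty subcollection of facets has a leaf) whose facet ideal has a linear resolution,
then there is an ordering of the facets which is simultaneously a good leaf ordering and
satisfies `dist(F_i, F_{i+1}) = 1` (equivalently `|F_i ∩ F_{i+1}| = |F_{i+1}| - 1`)
for all `i`. -/
theorem good_leaf_distance_one_ordering
    {k σ : Type} [Field k] [Fintype σ] [DecidableEq σ] {r : ℕ}
    (F : Fin r → Finset σ)
    (hne : ∀ i, (F i).Nonempty)
    (hfacet : ∀ i j, i ≠ j → ¬ F i ⊆ F j)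
    (hforest : ∀ S : Finset (Fin r), S.Nonempty → ∃ i ∈ S,
      (S = {i} ∨ ∃ j ∈ S, j ≠ i ∧ ∀ l ∈ S, l ≠ i → F l ∩ F i ⊆ F j ∩ F i))
    (hconn : ∀ i j : Fin r,
      Relation.ReflTransGen (fun p q : Fin r => (F p ∩ F q).Nonempty) i j)
    (hlin : HasLinearResolution k σ
      (Ideal.span (Set.range fun i => ∏ v ∈ F i, (X v : MvPolynomial σ k)))) :
    ∃ g : Equiv.Perm (Fin r),
      (∀ i j l : Fin r, j < i → l < i →
        (F (g j) ∩ F (g i) ⊆ F (g l) ∩ F (g i) ∨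
          F (g l) ∩ F (g i) ⊆ F (g j) ∩ F (g i))) ∧
      (∀ i : Fin r, ∀ hi : i.val + 1 < r,
        (F (g i) ∩ F (g ⟨i.val + 1, hi⟩)).card + 1 = (F (g ⟨i.val + 1, hi⟩)).card) := by
  obtain ⟨t, ht, m, w, hw, hsyz, hgen⟩ := linear_conseq F hne hfacet hlin
  exact good_ordering F
    { card := ht
      anti := hfacet
      forest := hforest
      conn := conn_of_syz F hfacet w hw hsyz hgen }
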